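/- arXiv:1203.1943 — 2 statements merged into one kernel-verified Lean document; each statement's English description precedes it below -/
import Mathlib

section
/- Let k be a field, A a finite-dimensional k-algebra, and S a simple A-module with Ext¹_A(S,S) = 0. Then for every finite-dimensional A-module M, the trace of S in the quotient module P_S(M) = M ⧸ t_S(M) is zero, i.e. t_S(M ⧸ t_S(M)) = ⊥ (equivalently, every A-linear map S → M ⧸ t_S(M) is zero); in particular P_S(P_S(M)) is isomorphic to P_S(M) as an A-module. -/
/-- The trace `t_U(M)` of a module `U` in a module `M`: the largest submodule of `M`
generated by homomorphic images of `U`. -/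
def moduleTrace (A : Type) [Ring A] (U : Type) [AddCommGroup U] [Module A U]
    (M : Type) [AddCommGroup M] [Module A M] : Submodule A M :=
  ⨆ f : U →ₗ[A] M, LinearMap.range f

/-- The projection functor on objects: `P_U(M) = M ⧸ t_U(M)`. -/
abbrev moduleProj (A : Type) [Ring A] (U : Type) [AddCommGroup U] [Module A U]
    (M : Type) [AddCommGroup M] [Module A M] : Type :=
  M ⧸ moduleTrace A U M

namespace CategoryTheory.ProjectiveResolution

open Limits

/-- If `Ext¹(X, Y)` computed by a projective resolution `P` of `X` vanishes, then every
`1`-cocycle of `P` with values in `Y` is a coboundary. -/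
theorem exists_comp_eq_of_subsingleton_ext {R C : Type*} [Ring R] [Category* C] [Abelian C]
    [Linear R C] [EnoughProjectives C] {X Y : C} (P : ProjectiveResolution X)
    (h : Subsingleton (((Ext R C 1).obj (Opposite.op X)).obj Y))
    (φ : P.complex.X 1 ⟶ Y) (hφ : P.complex.d 2 1 ≫ φ = 0) :
    ∃ ψ : P.complex.X 0 ⟶ Y, P.complex.d 1 0 ≫ ψ = φ := by
  have hz : IsZero ((P.complex.linearYonedaObj R Y).homology 1) :=
    (ModuleCat.isZero_of_subsingleton _).of_iso (P.isoExt (R := R) 1 Y).symm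
  rw [← HomologicalComplex.exactAt_iff_isZero_homology,
    HomologicalComplex.exactAt_iff' _ 0 1 2 (by simp) (by simp),
    ShortComplex.moduleCat_exact_iff] at hz
  exact hz φ hφ

/-- A morphism from `X` to the cokernel of a short exact sequence lifts if `1`-cocycles of a
projective resolution of `X` with values in the kernel are coboundaries. -/
theorem exists_lift_of_shortExact {C : Type*} [Category* C] [Abelian C] {X : C}
    (P : ProjectiveResolution X) {S : ShortComplex C} (hS : S.ShortExact)
    (h : ∀ φ : P.complex.X 1 ⟶ S.X₁, P.complex.d 2 1 ≫ φ = 0 →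
      ∃ ψ : P.complex.X 0 ⟶ S.X₁, P.complex.d 1 0 ≫ ψ = φ)
    (f : X ⟶ S.X₃) : ∃ s : X ⟶ S.X₂, s ≫ S.g = f := by
  have := hS.mono_f
  have := hS.epi_g
  let p : P.complex.X 0 ⟶ X := P.π.f 0
  have : Epi p := inferInstanceAs (Epi (P.π.f 0))
  have hp : P.complex.d 1 0 ≫ p = 0 := P.complex_d_comp_π_f_zero
  let g : P.complex.X 0 ⟶ S.X₂ := Projective.factorThru (p ≫ f) S.g
  have hg : g ≫ S.g = p ≫ f := Projective.factorThru_comp _ _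
  let φ := hS.exact.lift (P.complex.d 1 0 ≫ g)
    (by rw [Category.assoc, hg, reassoc_of% hp, zero_comp])
  have hφ : φ ≫ S.f = P.complex.d 1 0 ≫ g := hS.exact.lift_f _ _
  obtain ⟨ψ, hψ⟩ := h φ (by rw [← cancel_mono S.f, Category.assoc, hφ]; simp)
  obtain ⟨s, hs⟩ : ∃ s : X ⟶ S.X₂, p ≫ s = g - ψ ≫ S.f :=
    let ⟨s, hs⟩ := CokernelCofork.IsColimit.desc' P.isColimitCokernelCofork (g - ψ ≫ S.f)
      (by rw [Preadditive.comp_sub, reassoc_of% hψ, hφ, sub_self])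
    ⟨s, hs⟩
  exact ⟨s, by rw [← cancel_epi p, ← Category.assoc, hs]; simp [hg]⟩

end CategoryTheory.ProjectiveResolution

/-- The trace of a simple module in a Noetherian module is a finite power of that module. -/
theorem exists_linearEquiv_moduleTrace (A : Type) [Ring A] (S : Type) [AddCommGroup S]
    [Module A S] [IsSimpleModule A S] (M : Type) [AddCommGroup M] [Module A M]
    [IsNoetherian A M] : ∃ n : ℕ, Nonempty (moduleTrace A S M ≃ₗ[A] (Fin n → S)) := by
  have : IsSemisimpleModule A (moduleTrace A S M) := by
    have := isSemisimpleModule_biSup_of_isSemisimpleModule_submodule (s := Set.univ)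
      (p := fun f : S →ₗ[A] M ↦ LinearMap.range f) fun f _ ↦ .range f
    rwa [iSup_univ] at this
  have hle : moduleTrace A S M ≤ isotypicComponent A M S := by
    refine iSup_le fun f ↦ ?_
    rcases f.injective_or_eq_zero with hf | rfl
    · exact le_sSup ⟨(LinearEquiv.ofInjective f hf).symm⟩
    · simp
  exact (IsIsotypicOfType.of_injective (IsIsotypicOfType.isotypicComponent A M S)
    (Submodule.inclusion hle) (Submodule.inclusion_injective hle)).linearEquiv_fun

open CategoryTheory in
/-- If `Ext¹(S, S) = 0` for a simple module `S`, every map from `S` to a quotient `M ⧸ t_S(M)`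
vanishes. -/
theorem eq_zero_of_subsingleton_ext (k : Type) [Field k] (A : Type) [Ring A] [Algebra k A]
    (S : Type) [AddCommGroup S] [Module A S] [IsSimpleModule A S]
    (hExt : Subsingleton (((Ext k (ModuleCat A) 1).obj
        (Opposite.op (ModuleCat.of A S))).obj (ModuleCat.of A S)))
    (M : Type) [AddCommGroup M] [Module A M] [IsNoetherian A M]
    (f : S →ₗ[A] moduleProj A S M) : f = 0 := by
  obtain ⟨n, ⟨e⟩⟩ := exists_linearEquiv_moduleTrace A S M
  let P := projectiveResolution (ModuleCat.of A S)
  let E : ShortComplex (ModuleCat A) := ShortComplex.mk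
    (ModuleCat.ofHom (moduleTrace A S M).subtype) (ModuleCat.ofHom (moduleTrace A S M).mkQ)
    (by ext x; simp)
  have hE : E.ShortExact :=
    { exact := by
        rw [ShortComplex.moduleCat_exact_iff_range_eq_ker]
        simp [E]
      mono_f := (ModuleCat.mono_iff_injective _).2 (Submodule.subtype_injective _)
      epi_g := (ModuleCat.epi_iff_surjective _).2 (Submodule.mkQ_surjective _) }
  obtain ⟨s, hs⟩ := P.exists_lift_of_shortExact hE (fun φ hφ ↦ by
    let pr (i : Fin n) : E.X₁ ⟶ ModuleCat.of A S :=
      ModuleCat.ofHom (LinearMap.proj i ∘ₗ e.toLinearMap)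
    choose ψ hψ using fun i ↦ P.exists_comp_eq_of_subsingleton_ext hExt (φ ≫ pr i)
      (by rw [reassoc_of% hφ, Limits.zero_comp])
    refine ⟨ModuleCat.ofHom (e.symm.toLinearMap ∘ₗ LinearMap.pi fun i ↦ (ψ i).hom), ?_⟩
    refine ModuleCat.hom_ext (LinearMap.ext fun x ↦ e.injective (funext fun i ↦ ?_))
    simpa [pr] using LinearMap.congr_fun (congrArg ModuleCat.Hom.hom (hψ i)) x) (ModuleCat.ofHom f)
  ext x
  refine (LinearMap.congr_fun (congrArg ModuleCat.Hom.hom hs) x).symm.trans ?_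
  exact (Submodule.Quotient.mk_eq_zero _).2
    (Submodule.mem_iSup_of_mem s.hom (LinearMap.mem_range_self s.hom x))

open CategoryTheory in
/-- Let `k` be a field, `A` a finite-dimensional `k`-algebra and `S` a
simple `A`-module with `Ext¹_A(S,S) = 0`.  Then for every finite-dimensional
`A`-module `M`, the trace of `S` in `P_S(M) = M ⧸ t_S(M)` is zero (equivalently, every
`A`-linear map `S → M ⧸ t_S(M)` is zero); in particular `P_S(P_S(M)) ≅ P_S(M)` as
`A`-modules. -/
theorem trace_of_proj_eq_bot (k : Type) [Field k] (A : Type) [Ring A] [Algebra k A]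
    [FiniteDimensional k A]
    (S : Type) [AddCommGroup S] [Module A S] [Module k S] [IsScalarTower k A S]
    [FiniteDimensional k S] (hS : IsSimpleModule A S)
    (hExt : Subsingleton (((Ext k (ModuleCat A) 1).obj
        (Opposite.op (ModuleCat.of A S))).obj (ModuleCat.of A S)))
    (M : Type) [AddCommGroup M] [Module A M] [Module k M] [IsScalarTower k A M]
    [FiniteDimensional k M] :
    moduleTrace A S (moduleProj A S M) = ⊥ ∧
    (∀ f : S →ₗ[A] moduleProj A S M, f = 0) ∧
    Nonempty (moduleProj A S (moduleProj A S M) ≃ₗ[A] moduleProj A S M) := by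
  have : IsNoetherian A M := isNoetherian_of_tower k inferInstance
  have hf (f : S →ₗ[A] moduleProj A S M) : f = 0 := eq_zero_of_subsingleton_ext k A S hExt M f
  have ht : moduleTrace A S (moduleProj A S M) = ⊥ :=
    iSup_eq_bot.2 fun f ↦ by rw [hf f, LinearMap.range_zero]
  exact ⟨ht, hf, ⟨Submodule.quotEquivOfEqBot _ ht⟩⟩
end

section
/- Let k be a field, A a finite-dimensional k-algebra, and S, T simple A-modules with Ext¹_A(S,S) = 0, Ext¹_A(T,T) = 0 and Ext¹_A(T,S) = 0. Then for every finite-dimensional A-module M there are A-module isomorphisms P_S(P_T(P_S(M))) ≅ P_S(P_T(M)) and P_T(P_S(P_T(M))) ≅ P_S(P_T(M)). -/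
section Trace

variable {A : Type} [Ring A] {U : Type} [AddCommGroup U] [Module A U]
  {M : Type} [AddCommGroup M] [Module A M] {X : Type} [AddCommGroup X] [Module A X]

theorem range_le_moduleTrace (f : U →ₗ[A] M) : LinearMap.range f ≤ moduleTrace A U M :=
  le_iSup (fun f : U →ₗ[A] M => LinearMap.range f) f

theorem moduleTrace_eq_bot [Subsingleton (U →ₗ[A] M)] : moduleTrace A U M = ⊥ := by
  rw [moduleTrace, iSup_eq_bot]
  intro f
  rw [Subsingleton.elim f 0, LinearMap.range_zero]

theorem moduleTrace_le_ker [Subsingleton (U →ₗ[A] X)] (f : M →ₗ[A] X) :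
    moduleTrace A U M ≤ LinearMap.ker f := by
  refine iSup_le fun g => ?_
  rw [LinearMap.range_le_ker_iff]
  exact Subsingleton.elim _ _

/-- A linear map into a module receiving no nonzero map from `U` factors through `P_U`. -/
theorem exists_comp_mkQ_moduleTrace [Subsingleton (U →ₗ[A] X)] (f : M →ₗ[A] X) :
    ∃ g : moduleProj A U M →ₗ[A] X, g ∘ₗ (moduleTrace A U M).mkQ = f :=
  ⟨(moduleTrace A U M).liftQ f (moduleTrace_le_ker f), Submodule.liftQ_mkQ _ _ _⟩

theorem moduleTrace_le_isotypicComponent [IsSimpleModule A U] :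
    moduleTrace A U M ≤ isotypicComponent A M U := by
  refine iSup_le fun f => ?_
  rcases LinearMap.injective_or_eq_zero f with hf | rfl
  · exact le_sSup ⟨(LinearEquiv.ofInjective f hf).symm⟩
  · simp

theorem exists_moduleTrace_linearEquiv_fun [IsSimpleModule A U] [IsNoetherian A M] :
    ∃ n : ℕ, Nonempty (moduleTrace A U M ≃ₗ[A] (Fin n → U)) := by
  have hle := moduleTrace_le_isotypicComponent (A := A) (U := U) (M := M)
  have hinj := Submodule.inclusion_injective hle
  have : IsSemisimpleModule A (moduleTrace A U M) :=
    IsSemisimpleModule.of_injective _ hinj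
  exact ((IsIsotypicOfType.isotypicComponent A M U).of_injective _ hinj).linearEquiv_fun

end Trace

section Lifting

open CategoryTheory

variable {k : Type} [Field k] {A : Type} [Ring A] [Algebra k A]

/-- If `Ext¹(T, V) = 0`, every 1-cocycle of a projective resolution of `T` with values in `V`
is a coboundary. -/
theorem CategoryTheory.ProjectiveResolution.exists_d_comp_eq {T V : ModuleCat.{0} A}
    (P : ProjectiveResolution T)
    (h : Subsingleton (((Ext k (ModuleCat A) 1).obj (Opposite.op T)).obj V))
    (φ : P.complex.X 1 ⟶ V) (hφ : P.complex.d 2 1 ≫ φ = 0) :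
    ∃ ψ : P.complex.X 0 ⟶ V, P.complex.d 1 0 ≫ ψ = φ := by
  have hz : Limits.IsZero ((P.complex.linearYonedaObj k V).homology 1) :=
    (ModuleCat.isZero_of_subsingleton _).of_iso (P.isoExt 1 V).symm
  rw [← HomologicalComplex.exactAt_iff_isZero_homology,
    HomologicalComplex.exactAt_iff' _ 0 1 2 (by simp) (by simp),
    ShortComplex.moduleCat_exact_iff] at hz
  exact hz φ hφ

variable {S : Type} [AddCommGroup S] [Module A S] {T : Type} [AddCommGroup T] [Module A T]
  {N : Type} [AddCommGroup N] [Module A N]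

/-- If `Ext¹(T, S) = 0`, maps from `T` lift along quotients by finite powers of `S`. -/
theorem exists_mkQ_comp_eq_of_ext
    (h : Subsingleton (((Ext k (ModuleCat A) 1).obj
        (Opposite.op (ModuleCat.of A T))).obj (ModuleCat.of A S)))
    (W : Submodule A N) {n : ℕ} (e : W ≃ₗ[A] (Fin n → S)) (f : T →ₗ[A] N ⧸ W) :
    ∃ g : T →ₗ[A] N, W.mkQ ∘ₗ g = f := by
  let P : ProjectiveResolution (ModuleCat.of A T) := ProjectiveResolution.of _
  let π : P.complex.X 0 →ₗ[A] T := (P.π.f 0).hom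
  have hπ : Function.Surjective π :=
    (ModuleCat.epi_iff_surjective (P.π.f 0)).mp inferInstance
  let d : P.complex.X 1 →ₗ[A] P.complex.X 0 := (P.complex.d 1 0).hom
  have hdd (x) : d ((P.complex.d 2 1).hom x) = 0 :=
    LinearMap.congr_fun (congrArg ModuleCat.Hom.hom (P.complex.d_comp_d 2 1 0)) x
  have hker : LinearMap.ker π ≤ LinearMap.range d :=
    (ShortComplex.moduleCat_exact_iff_ker_sub_range _).mp P.exact₀
  have hπd (x) : π (d x) = 0 :=
    LinearMap.congr_fun (congrArg ModuleCat.Hom.hom P.complex_d_comp_π_f_zero) x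
  have : Module.Projective A (P.complex.X 0) :=
    (IsProjective.iff_projective (P := P.complex.X 0)).mpr (P.projective 0)
  obtain ⟨l, hl⟩ := Module.projective_lifting_property W.mkQ (f ∘ₗ π) W.mkQ_surjective
  have hlW (x) : l (d x) ∈ W := by
    rw [← W.ker_mkQ, LinearMap.mem_ker]
    have := LinearMap.congr_fun hl (d x)
    simpa [hπd] using this
  let c : P.complex.X 1 →ₗ[A] W := (l ∘ₗ d).codRestrict W hlW
  have hc (i : Fin n) : ∃ ψ : P.complex.X 0 →ₗ[A] S,
      ψ ∘ₗ d = LinearMap.proj i ∘ₗ e.toLinearMap ∘ₗ c := by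
    obtain ⟨ψ, hψ⟩ := P.exists_d_comp_eq h
      (ModuleCat.ofHom (LinearMap.proj i ∘ₗ e.toLinearMap ∘ₗ c)) (by
        ext x
        have : c ((P.complex.d 2 1).hom x) = 0 := by
          ext
          simp [c, hdd]
        simp [this])
    exact ⟨ψ.hom, congrArg ModuleCat.Hom.hom hψ⟩
  choose ψ hψ using hc
  let Ψ : P.complex.X 0 →ₗ[A] W := e.symm.toLinearMap ∘ₗ LinearMap.pi ψ
  have hΨ (x) : Ψ (d x) = c x := by
    apply e.injective
    ext i
    simpa [Ψ] using LinearMap.congr_fun (hψ i) x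
  have hle : LinearMap.ker π ≤ LinearMap.ker (l - W.subtype ∘ₗ Ψ) := by
    intro x hx
    obtain ⟨y, rfl⟩ := hker hx
    simp [hΨ, c]
  refine ⟨(LinearMap.ker π).liftQ _ hle ∘ₗ
    (π.quotKerEquivOfSurjective hπ).symm.toLinearMap, ?_⟩
  ext t
  obtain ⟨x, rfl⟩ := hπ t
  have hx : (π.quotKerEquivOfSurjective hπ).symm (π x) = (LinearMap.ker π).mkQ x := by
    rw [LinearEquiv.symm_apply_eq]
    rfl
  have hlx : W.mkQ (l x) = f (π x) := LinearMap.congr_fun hl x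
  simp only [LinearMap.comp_apply, LinearEquiv.coe_coe, hx]
  rw [Submodule.mkQ_apply (LinearMap.ker π), Submodule.liftQ_apply, LinearMap.sub_apply,
    map_sub, hlx]
  simp

theorem subsingleton_hom_moduleProj_self [IsSimpleModule A S] [IsNoetherian A N]
    (h : Subsingleton (((Ext k (ModuleCat A) 1).obj
        (Opposite.op (ModuleCat.of A S))).obj (ModuleCat.of A S))) :
    Subsingleton (S →ₗ[A] moduleProj A S N) := by
  obtain ⟨n, ⟨e⟩⟩ := exists_moduleTrace_linearEquiv_fun (A := A) (U := S) (M := N)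
  refine subsingleton_of_forall_eq 0 fun f => ?_
  obtain ⟨g, rfl⟩ := exists_mkQ_comp_eq_of_ext h _ e f
  rw [← LinearMap.range_le_ker_iff, Submodule.ker_mkQ]
  exact range_le_moduleTrace g

theorem subsingleton_hom_moduleProj [IsSimpleModule A S] [IsNoetherian A N]
    (h : Subsingleton (((Ext k (ModuleCat A) 1).obj
        (Opposite.op (ModuleCat.of A T))).obj (ModuleCat.of A S)))
    [Subsingleton (T →ₗ[A] N)] :
    Subsingleton (T →ₗ[A] moduleProj A S N) := by
  obtain ⟨n, ⟨e⟩⟩ := exists_moduleTrace_linearEquiv_fun (A := A) (U := S) (M := N)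
  refine subsingleton_of_forall_eq 0 fun f => ?_
  obtain ⟨g, rfl⟩ := exists_mkQ_comp_eq_of_ext h _ e f
  rw [Subsingleton.elim g 0, LinearMap.comp_zero]

end Lifting

open CategoryTheory in
/-- Let `k` be a field, `A` a finite-dimensional `k`-algebra, and
`S`, `T` simple `A`-modules with `Ext¹_A(S,S) = 0`, `Ext¹_A(T,T) = 0` and
`Ext¹_A(T,S) = 0`.  Then for every finite-dimensional `A`-module `M` there are
`A`-module isomorphisms `P_S(P_T(P_S(M))) ≅ P_S(P_T(M))` and
`P_T(P_S(P_T(M))) ≅ P_S(P_T(M))`. -/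
theorem proj_braid_relations (k : Type) [Field k] (A : Type) [Ring A] [Algebra k A]
    [FiniteDimensional k A]
    (S : Type) [AddCommGroup S] [Module A S] [Module k S] [IsScalarTower k A S]
    [FiniteDimensional k S] (hS : IsSimpleModule A S)
    (T : Type) [AddCommGroup T] [Module A T] [Module k T] [IsScalarTower k A T]
    [FiniteDimensional k T] (hT : IsSimpleModule A T)
    (hExtSS : Subsingleton (((Ext k (ModuleCat A) 1).obj
        (Opposite.op (ModuleCat.of A S))).obj (ModuleCat.of A S)))
    (hExtTT : Subsingleton (((Ext k (ModuleCat A) 1).obj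
        (Opposite.op (ModuleCat.of A T))).obj (ModuleCat.of A T)))
    (hExtTS : Subsingleton (((Ext k (ModuleCat A) 1).obj
        (Opposite.op (ModuleCat.of A T))).obj (ModuleCat.of A S)))
    (M : Type) [AddCommGroup M] [Module A M] [Module k M] [IsScalarTower k A M]
    [FiniteDimensional k M] :
    Nonempty (moduleProj A S (moduleProj A T (moduleProj A S M)) ≃ₗ[A]
      moduleProj A S (moduleProj A T M)) ∧
    Nonempty (moduleProj A T (moduleProj A S (moduleProj A T M)) ≃ₗ[A]
      moduleProj A S (moduleProj A T M)) := by
  have : IsNoetherian A M := isNoetherian_of_tower k inferInstance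
  have hTTM : Subsingleton (T →ₗ[A] moduleProj A T M) := subsingleton_hom_moduleProj_self hExtTT
  have hTTSM : Subsingleton (T →ₗ[A] moduleProj A T (moduleProj A S M)) :=
    subsingleton_hom_moduleProj_self hExtTT
  have hT₁ : Subsingleton (T →ₗ[A] moduleProj A S (moduleProj A T M)) :=
    subsingleton_hom_moduleProj hExtTS
  have hS₁ : Subsingleton (S →ₗ[A] moduleProj A S (moduleProj A T M)) :=
    subsingleton_hom_moduleProj_self hExtSS
  have hT₂ : Subsingleton (T →ₗ[A] moduleProj A S (moduleProj A T (moduleProj A S M))) :=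
    subsingleton_hom_moduleProj hExtTS
  have hS₂ : Subsingleton (S →ₗ[A] moduleProj A S (moduleProj A T (moduleProj A S M))) :=
    subsingleton_hom_moduleProj_self hExtSS
  refine ⟨?_, ⟨Submodule.quotEquivOfEqBot _ moduleTrace_eq_bot⟩⟩
  let q₁ : M →ₗ[A] moduleProj A S (moduleProj A T M) :=
    (moduleTrace A S (moduleProj A T M)).mkQ ∘ₗ (moduleTrace A T M).mkQ
  let q₂ : M →ₗ[A] moduleProj A S (moduleProj A T (moduleProj A S M)) :=
    (moduleTrace A S (moduleProj A T (moduleProj A S M))).mkQ ∘ₗ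
      (moduleTrace A T (moduleProj A S M)).mkQ ∘ₗ (moduleTrace A S M).mkQ
  have hq₁ : Function.Surjective q₁ :=
    (Submodule.mkQ_surjective _).comp (Submodule.mkQ_surjective _)
  have hq₂ : Function.Surjective q₂ :=
    (Submodule.mkQ_surjective _).comp
      ((Submodule.mkQ_surjective _).comp (Submodule.mkQ_surjective _))
  have h₁₂ : LinearMap.ker q₁ ≤ LinearMap.ker q₂ := by
    obtain ⟨g, hg⟩ := exists_comp_mkQ_moduleTrace (U := T) q₂
    obtain ⟨g', hg'⟩ := exists_comp_mkQ_moduleTrace (U := S) g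
    rw [← hg, ← hg', LinearMap.comp_assoc]
    exact LinearMap.ker_le_ker_comp q₁ g'
  have h₂₁ : LinearMap.ker q₂ ≤ LinearMap.ker q₁ := by
    obtain ⟨g, hg⟩ := exists_comp_mkQ_moduleTrace (U := S) q₁
    obtain ⟨g', hg'⟩ := exists_comp_mkQ_moduleTrace (U := T) g
    obtain ⟨g'', hg''⟩ := exists_comp_mkQ_moduleTrace (U := S) g'
    rw [← hg, ← hg', ← hg'', LinearMap.comp_assoc, LinearMap.comp_assoc]
    exact LinearMap.ker_le_ker_comp q₂ g''
  exact ⟨(q₂.quotKerEquivOfSurjective hq₂).symm ≪≫ₗ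
    Submodule.quotEquivOfEq _ _ (le_antisymm h₂₁ h₁₂) ≪≫ₗ q₁.quotKerEquivOfSurjective hq₁⟩
end
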